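/- Under the protocol, suppose G(t) is B-core-connected, D = sup_{i,j,t} D(i,j,t) is finite, and t is a multiple of B satisfying t ≥ 2^{2/(1−α)} ⌈32B + 8B·W(0)⌉^{1/(β−α)} + (32B·‖x(0)‖_∞)^{2/(1−α)} and V2(t) ≥ 8 n^{1.5} / t^α. Then V2(t + 3B) ≤ (1 − 1/(50 n³ D (t+3B)^β)) V2(t). -/

import Mathlib

open scoped Classical

noncomputable section

/-- The rounding function `R` sending `x` to `1`, `0`, `-1` according to `x > 1`,
`-1 ≤ x ≤ 1`, `x < -1`. -/
def Rq (y : ℝ) : ℝ := if y > 1 then 1 else if y < -1 then -1 else 0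

/-- The data and evolution equations of the ternary-message average-consensus protocol
on `n` nodes.  `E t i j` means the edge `(i,j)` is present in the graph `G(t)`
(for `t ≥ 1`); `x t i` is the value of node `i` at time `t`; `xin t i j` is
`x̂_{i,j,in}(t)`, `xout t i j` is `x̂_{i,j,out}(t)` and `q t i j` is `q_{i→j}(t)`. -/
structure Protocol (n : ℕ) where
  α : ℝ
  β : ℝ
  hα : 0 < α
  hαβ : α < β
  hβ : β < 1
  E : ℕ → Fin n → Fin n → Prop
  Esymm : ∀ t i j, E t i j → E t j i
  Eirrefl : ∀ t i, ¬ E t i i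
  D : Fin n → Fin n → ℕ → ℝ
  Dsymm : ∀ i j t, D i j t = D j i t
  Dbound : ∀ t i j, E t i j →
    ((max (Set.ncard {k | E t i k}) (Set.ncard {k | E t j k}) : ℕ) : ℝ) ≤ D i j t
  x : ℕ → Fin n → ℝ
  xin : ℕ → Fin n → Fin n → ℝ
  xout : ℕ → Fin n → Fin n → ℝ
  q : ℕ → Fin n → Fin n → ℝ
  hxin0 : ∀ i j, xin 0 i j = 0
  hxout0 : ∀ i j, xout 0 i j = 0
  hq : ∀ t, 1 ≤ t → ∀ i j, E t i j →
    q t i j = Rq ((t : ℝ) ^ α * (x (t - 1) i - xout (t - 1) i j))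
  hxoutE : ∀ t, 1 ≤ t → ∀ i j, E t i j →
    xout t i j = xout (t - 1) i j + q t i j / (t : ℝ) ^ α
  hxinE : ∀ t, 1 ≤ t → ∀ i j, E t i j →
    xin t i j = xin (t - 1) i j + q t j i / (t : ℝ) ^ α
  hxoutN : ∀ t, 1 ≤ t → ∀ i j, ¬ E t i j → xout t i j = xout (t - 1) i j
  hxinN : ∀ t, 1 ≤ t → ∀ i j, ¬ E t i j → xin t i j = xin (t - 1) i j
  hx : ∀ t, 1 ≤ t → ∀ i, x t i = x (t - 1) i + (1 / (t : ℝ) ^ β) *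
    ∑ j ∈ Finset.univ.filter (fun j => E t i j ∧
        4 / (t : ℝ) ^ α < |xin t i j - xout t i j| ∧ q t j i = 0 ∧ q t i j = 0),
      (xin t i j - xout t i j) / (4 * D i j t)

namespace Protocol

variable {n : ℕ} (P : Protocol n)

/-- The set `S(i,t)` of neighbors that node `i` includes in its update at time `t`. -/
def S (t : ℕ) (i : Fin n) : Finset (Fin n) :=
  Finset.univ.filter (fun j => P.E t i j ∧
    4 / (t : ℝ) ^ P.α < |P.xin t i j - P.xout t i j| ∧ P.q t j i = 0 ∧ P.q t i j = 0)

/-- The graph sequence of the protocol is `B`-core-connected with core edge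
relation `Einf`: every core edge appears at some time, the graph of core edges is
connected, and every core edge appears in every time window `[kB+1, (k+1)B]`. -/
def CoreConnected (B : ℕ) (Einf : Fin n → Fin n → Prop) : Prop :=
  (∀ i j, Einf i j → ∃ t, 1 ≤ t ∧ P.E t i j) ∧
  (SimpleGraph.fromRel Einf).Connected ∧
  ∀ k : ℕ, ∀ i j, Einf i j → ∃ t, k * B + 1 ≤ t ∧ t ≤ (k + 1) * B ∧ P.E t i j

end Protocol

/-- `M(x)`: the largest coordinate. -/
def maxV {n : ℕ} (y : Fin n → ℝ) : ℝ := ⨆ i, y i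

/-- `m(x)`: the smallest coordinate. -/
def minV {n : ℕ} (y : Fin n → ℝ) : ℝ := ⨅ i, y i

/-- `W(x) = M(x) - m(x)`. -/
def Wsp {n : ℕ} (y : Fin n → ℝ) : ℝ := maxV y - minV y

/-- The sup norm `‖x‖_∞ = max_i |x_i|`. -/
def normInf {n : ℕ} (y : Fin n → ℝ) : ℝ := ⨆ i, |y i|

/-- `V2(x) = sqrt(Σ_i (x_i - (1/n) Σ_j x_j)²)`. -/
def V2 {n : ℕ} (y : Fin n → ℝ) : ℝ :=
  Real.sqrt (∑ i, (y i - (∑ j, y j) / n) ^ 2)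

/-- The sum of squared deviations from the mean, i.e. the square of `V2`. -/
def sqDev {n : ℕ} (y : Fin n → ℝ) : ℝ := ∑ i, (y i - (∑ j, y j) / n) ^ 2

theorem sqDev_nonneg {n : ℕ} (y : Fin n → ℝ) : 0 ≤ sqDev y :=
  Finset.sum_nonneg fun _ _ => sq_nonneg _

/-- One averaging step with symmetric weights of row sums at most `1/2` decreases the squared
deviation by at least half of the weighted energy. -/
theorem sqDev_averaging_le {n : ℕ} (y y' : Fin n → ℝ) (a : Fin n → Fin n → ℝ)
    (hsymm : ∀ i j, a i j = a j i) (hnonneg : ∀ i j, 0 ≤ a i j) (hsum : ∀ i, ∑ j, a i j ≤ 1 / 2)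
    (hy : ∀ i, y' i = y i + ∑ j, a i j * (y j - y i)) :
    sqDev y' + 1 / 2 * ∑ i, ∑ j, a i j * (y j - y i) ^ 2 ≤ sqDev y := by
  have hmean : ∑ i, y' i = ∑ i, y i := by
    have h : ∑ i, ∑ j, a i j * (y j - y i) = 0 := by
      have h1 : ∑ i, ∑ j, a i j * (y j - y i) = ∑ i, ∑ j, a j i * (y i - y j) :=
        Finset.sum_comm
      have h2 : ∑ i, ∑ j, a j i * (y i - y j) = -∑ i, ∑ j, a i j * (y j - y i) := by
        simp only [← Finset.sum_neg_distrib]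
        refine Finset.sum_congr rfl fun i _ => Finset.sum_congr rfl fun j _ => ?_
        rw [hsymm j i]; ring
      linarith
    simp only [hy, Finset.sum_add_distrib, h, add_zero]
  unfold sqDev
  rw [hmean]
  set m := (∑ j, y j) / n
  have hcross : 2 * ∑ i, ∑ j, a i j * (y j - y i) * (y i - m)
      = -∑ i, ∑ j, a i j * (y j - y i) ^ 2 := by
    have h1 : ∑ i, ∑ j, a i j * (y j - y i) * (y i - m)
        = ∑ i, ∑ j, a j i * (y i - y j) * (y j - m) := Finset.sum_comm
    rw [two_mul]
    nth_rewrite 2 [h1]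
    simp only [← Finset.sum_neg_distrib, ← Finset.sum_add_distrib]
    refine Finset.sum_congr rfl fun i _ => Finset.sum_congr rfl fun j _ => ?_
    rw [hsymm j i]; ring
  have hcs : ∀ i, (∑ j, a i j * (y j - y i)) ^ 2 ≤ 1 / 2 * ∑ j, a i j * (y j - y i) ^ 2 := by
    intro i
    have hn : ∀ j ∈ Finset.univ, 0 ≤ a i j * (y j - y i) ^ 2 :=
      fun j _ => mul_nonneg (hnonneg i j) (sq_nonneg _)
    refine (Finset.sum_sq_le_sum_mul_sum_of_sq_le_mul Finset.univ (fun j _ => hnonneg i j) hn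
      (fun j _ => le_of_eq (by ring))).trans ?_
    exact mul_le_mul_of_nonneg_right (hsum i) (Finset.sum_nonneg hn)
  have hexp : ∑ i, (y' i - m) ^ 2 = ∑ i, (y i - m) ^ 2
      + 2 * ∑ i, ∑ j, a i j * (y j - y i) * (y i - m) + ∑ i, (∑ j, a i j * (y j - y i)) ^ 2 := by
    rw [Finset.mul_sum, ← Finset.sum_add_distrib, ← Finset.sum_add_distrib]
    refine Finset.sum_congr rfl fun i _ => ?_
    rw [hy i, ← Finset.sum_mul]; ring
  have hle := Finset.sum_le_sum fun i (_ : i ∈ Finset.univ) => hcs i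
  rw [← Finset.mul_sum] at hle
  linarith

/-- Averaging with nonnegative weights of row sum at most `1/2` stays in any interval. -/
theorem averaging_mem_Icc {n : ℕ} {y : Fin n → ℝ} {w : Fin n → ℝ} {i : Fin n} {lo hi : ℝ}
    (hw : ∀ j, 0 ≤ w j) (hsum : ∑ j, w j ≤ 1 / 2) (hy : ∀ j, y j ∈ Set.Icc lo hi) :
    y i + ∑ j, w j * (y j - y i) ∈ Set.Icc lo hi := by
  have h1 : ∑ j, w j * (y j - y i) ≤ (∑ j, w j) * (hi - y i) := by
    rw [Finset.sum_mul]
    exact Finset.sum_le_sum fun j _ => mul_le_mul_of_nonneg_left (by linarith [(hy j).2]) (hw j)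
  have h2 : (∑ j, w j) * (lo - y i) ≤ ∑ j, w j * (y j - y i) := by
    rw [Finset.sum_mul]
    exact Finset.sum_le_sum fun j _ => mul_le_mul_of_nonneg_left (by linarith [(hy j).1]) (hw j)
  have h0 : 0 ≤ ∑ j, w j := Finset.sum_nonneg fun j _ => hw j
  obtain ⟨hl, hr⟩ := hy i
  constructor <;> nlinarith

/-- In a connected graph some edge spans at least a `1/n` fraction of the root mean square
deviation. -/
theorem exists_adj_sqDev_le {n : ℕ} {G : SimpleGraph (Fin n)} (hG : G.Connected) (y : Fin n → ℝ)
    (hpos : 0 < sqDev y) : ∃ i j, G.Adj i j ∧ sqDev y ≤ (n : ℝ) ^ 3 * (y i - y j) ^ 2 := by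
  by_contra! hcon
  obtain ⟨k⟩ := hG.nonempty
  have hn : 0 < (n : ℝ) := by exact_mod_cast k.pos
  set c := √(sqDev y / (n : ℝ) ^ 3) with hc
  have hc0 : 0 ≤ c := Real.sqrt_nonneg _
  have hc2 : (n : ℝ) ^ 3 * c ^ 2 = sqDev y := by
    rw [hc, Real.sq_sqrt (by positivity)]; field_simp
  have hadj : ∀ i j, G.Adj i j → |y i - y j| ≤ c := by
    intro i j hij
    apply abs_le_of_sq_le_sq _ hc0
    have := hcon i j hij
    rw [← hc2] at this
    exact (lt_of_mul_lt_mul_left this (by positivity)).le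
  have hwalk : ∀ i j (p : G.Walk i j), |y i - y j| ≤ p.length * c := by
    intro i j p
    induction p with
    | nil => simp
    | cons h p ih =>
      rw [SimpleGraph.Walk.length_cons]
      push_cast
      have := hadj _ _ h
      have := abs_sub_le (y _) (y _) (y _) |>.trans (add_le_add this ih)
      linarith
  have hall : ∀ i j, |y i - y j| ≤ (n - 1) * c := by
    intro i j
    obtain ⟨p, hp⟩ := (hG.preconnected i j).exists_isPath
    refine (hwalk i j p).trans (mul_le_mul_of_nonneg_right ?_ hc0)
    have h := hp.length_lt
    rw [Fintype.card_fin] at h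
    have h' : (p.length : ℝ) + 1 ≤ n := by exact_mod_cast h
    linarith
  have hdev : ∀ i, |y i - (∑ j, y j) / n| ≤ (n - 1) * c := by
    intro i
    have h : y i - (∑ j, y j) / n = (∑ j, (y i - y j)) / n := by
      rw [Finset.sum_sub_distrib]; simp; field_simp
    rw [h, abs_div, abs_of_pos hn, div_le_iff₀ hn]
    refine (Finset.abs_sum_le_sum_abs _ _).trans ?_
    refine (Finset.sum_le_sum fun j _ => hall i j).trans ?_
    simp; linarith
  have hle : sqDev y ≤ n * ((n - 1) * c) ^ 2 := by
    unfold sqDev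
    refine (Finset.sum_le_sum fun i _ =>
      sq_le_sq' (abs_le.1 (hdev i)).1 (abs_le.1 (hdev i)).2).trans ?_
    simp
  have hn1 : (1 : ℝ) ≤ n := by exact_mod_cast k.pos
  have hcpos : 0 < c := Real.sqrt_pos.2 (by positivity)
  have : (n : ℝ) * ((n - 1) * c) ^ 2 < (n : ℝ) ^ 3 * c ^ 2 := by
    have : (n : ℝ) ^ 3 * c ^ 2 - (n : ℝ) * ((n - 1) * c) ^ 2 = n * c ^ 2 * (2 * n - 1) := by ring
    have : 0 < n * c ^ 2 * (2 * n - 1) := mul_pos (by positivity) (by linarith)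
    linarith
  linarith

theorem Rq_mul_self_sub {y : ℝ} (h : 1 < |y|) : |y - Rq y| = |y| - 1 := by
  unfold Rq
  rcases lt_abs.1 h with h' | h'
  · rw [if_pos h', abs_of_pos (by linarith), abs_of_pos (by linarith)]
  · rw [if_neg (by linarith), if_pos (by linarith), abs_of_neg (by linarith),
      abs_of_neg (by linarith)]
    ring

theorem Rq_eq_zero_iff {y : ℝ} : Rq y = 0 ↔ |y| ≤ 1 := by
  unfold Rq
  rw [abs_le]
  split_ifs with h1 h2
  · simp; intro; linarith
  · simp; intro; linarith
  · simp; constructor <;> linarith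

namespace Protocol

variable {n : ℕ} (P : Protocol n)

theorem xin_eq_xout_swap (t : ℕ) (i j : Fin n) : P.xin t i j = P.xout t j i := by
  induction t with
  | zero => rw [P.hxin0, P.hxout0]
  | succ t ih =>
    by_cases h : P.E (t + 1) i j
    · rw [P.hxinE _ (by omega) _ _ h, P.hxoutE _ (by omega) _ _ (P.Esymm _ _ _ h)]
      simp [ih]
    · rw [P.hxinN _ (by omega) _ _ h,
        P.hxoutN _ (by omega) _ _ (fun h' => h (P.Esymm _ _ _ h'))]
      simpa using ih

/-- The error of the estimate of `x_i` kept along the edge `(i,j)`. -/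
def err (t : ℕ) (i j : Fin n) : ℝ := P.x t i - P.xout t i j

theorem q_eq_zero_iff {t : ℕ} {i j : Fin n} (h : P.E (t + 1) i j) :
    P.q (t + 1) i j = 0 ↔ |P.err t i j| ≤ 1 / ((t + 1 : ℕ) : ℝ) ^ P.α := by
  have hpos : 0 < ((t + 1 : ℕ) : ℝ) ^ P.α := Real.rpow_pos_of_pos (by positivity) _
  rw [P.hq _ (by omega) _ _ h, Rq_eq_zero_iff, abs_mul, abs_of_pos hpos, le_div_iff₀' hpos]
  rfl

theorem xout_succ_of_q_eq_zero {t : ℕ} {i j : Fin n} (h : P.E (t + 1) i j)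
    (hq : P.q (t + 1) i j = 0) : P.xout (t + 1) i j = P.xout t i j := by
  rw [P.hxoutE _ (by omega) _ _ h, hq]; simp

theorem abs_sub_xout_succ_of_q_ne_zero {t : ℕ} {i j : Fin n} (h : P.E (t + 1) i j)
    (hq : P.q (t + 1) i j ≠ 0) :
    |P.x t i - P.xout (t + 1) i j| = |P.err t i j| - 1 / ((t + 1 : ℕ) : ℝ) ^ P.α := by
  have hpos : 0 < ((t + 1 : ℕ) : ℝ) ^ P.α := Real.rpow_pos_of_pos (by positivity) _
  have hlt := lt_of_not_ge fun hle => hq ((P.q_eq_zero_iff h).2 hle)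
  rw [div_lt_iff₀' hpos] at hlt
  rw [P.hxoutE _ (by omega) _ _ h, P.hq _ (by omega) _ _ h]
  set s := ((t + 1 : ℕ) : ℝ) ^ P.α
  have hR := Rq_mul_self_sub (y := s * P.err t i j) (by rwa [abs_mul, abs_of_pos hpos])
  have hval : P.x t i - (P.xout t i j + Rq (s * P.err t i j) / s)
      = (s * P.err t i j - Rq (s * P.err t i j)) / s := by
    unfold err; field_simp
    ring
  change |P.x t i - (P.xout t i j + Rq (s * P.err t i j) / s)| = _
  rw [hval, abs_div, hR, abs_mul, abs_of_pos hpos]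
  field_simp

theorem abs_sub_xout_succ_le (t : ℕ) (i j : Fin n) :
    |P.x t i - P.xout (t + 1) i j| ≤ |P.err t i j| := by
  by_cases h : P.E (t + 1) i j
  · by_cases hq : P.q (t + 1) i j = 0
    · rw [P.xout_succ_of_q_eq_zero h hq, err]
    · rw [P.abs_sub_xout_succ_of_q_ne_zero h hq]
      have : 0 < ((t + 1 : ℕ) : ℝ) ^ P.α := Real.rpow_pos_of_pos (by positivity) _
      linarith [one_div_pos.2 this]
  · rw [P.hxoutN _ (by omega) _ _ h]; simp [err]

theorem one_le_D {t : ℕ} {i j : Fin n} (h : P.E t i j) : 1 ≤ P.D i j t := by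
  refine le_trans ?_ (P.Dbound t i j h)
  have : 0 < Set.ncard {k | P.E t i k} := (Set.ncard_pos (Set.toFinite _)).2 ⟨j, h⟩
  exact_mod_cast le_max_of_le_left this

theorem mem_S {t : ℕ} {i j : Fin n} : j ∈ P.S t i ↔ P.E t i j ∧
    4 / (t : ℝ) ^ P.α < |P.xin t i j - P.xout t i j| ∧ P.q t j i = 0 ∧ P.q t i j = 0 := by
  simp [S]

theorem mem_S_comm {t : ℕ} {i j : Fin n} : j ∈ P.S t i ↔ i ∈ P.S t j := by
  have key : ∀ i j, j ∈ P.S t i → i ∈ P.S t j := by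
    intro i j h
    obtain ⟨hE, hlt, h1, h2⟩ := P.mem_S.1 h
    refine P.mem_S.2 ⟨P.Esymm _ _ _ hE, ?_, h2, h1⟩
    rwa [P.xin_eq_xout_swap, ← P.xin_eq_xout_swap t i j, abs_sub_comm]
  exact ⟨key i j, key j i⟩

theorem card_S_le_D {t : ℕ} {i j : Fin n} (h : j ∈ P.S t i) : ((P.S t i).card : ℝ) ≤ P.D i j t := by
  refine le_trans ?_ (P.Dbound t i j (P.mem_S.1 h).1)
  have : (P.S t i).card ≤ Set.ncard {k | P.E t i k} := by
    rw [← Set.ncard_coe_finset]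
    exact Set.ncard_le_ncard (fun k hk => (P.mem_S.1 (Finset.mem_coe.1 hk)).1) (Set.toFinite _)
  exact_mod_cast le_max_of_le_left this

/-- The effective averaging weights: the update at time `t + 1` is
`x_i(t+1) = x_i(t) + Σ_j weight t i j * (x_j(t) - x_i(t))`. -/
def weight (t : ℕ) (i j : Fin n) : ℝ :=
  if j ∈ P.S (t + 1) i then
    (P.xin (t + 1) i j - P.xout (t + 1) i j) / (P.x t j - P.x t i) /
      (4 * P.D i j (t + 1) * ((t + 1 : ℕ) : ℝ) ^ P.β)
  else 0

theorem ratio_bounds_of_mem_S {t : ℕ} {i j : Fin n} (h : j ∈ P.S (t + 1) i) :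
    P.x t j - P.x t i ≠ 0 ∧
    2 / 3 ≤ (P.xin (t + 1) i j - P.xout (t + 1) i j) / (P.x t j - P.x t i) ∧
    (P.xin (t + 1) i j - P.xout (t + 1) i j) / (P.x t j - P.x t i) ≤ 2 := by
  obtain ⟨hE, hlt, h1, h2⟩ := P.mem_S.1 h
  have hE' := P.Esymm _ _ _ hE
  have e1 := (P.q_eq_zero_iff hE').1 h1
  have e2 := (P.q_eq_zero_iff hE).1 h2
  rw [P.xin_eq_xout_swap, P.xout_succ_of_q_eq_zero hE' h1, P.xout_succ_of_q_eq_zero hE h2] at *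
  unfold err at e1 e2
  have ha : 4 / ((t + 1 : ℕ) : ℝ) ^ P.α = 4 * (1 / ((t + 1 : ℕ) : ℝ) ^ P.α) := by ring
  rw [ha] at hlt
  set a := 1 / ((t + 1 : ℕ) : ℝ) ^ P.α
  obtain ⟨e1l, e1r⟩ := abs_le.1 e1
  obtain ⟨e2l, e2r⟩ := abs_le.1 e2
  rcases lt_abs.1 hlt with h' | h'
  · have hd : 0 < P.x t j - P.x t i := by linarith
    refine ⟨hd.ne', ?_, ?_⟩
    · rw [le_div_iff₀ hd]; linarith
    · rw [div_le_iff₀ hd]; linarith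
  · have hd : P.x t j - P.x t i < 0 := by linarith
    refine ⟨hd.ne, ?_, ?_⟩
    · rw [le_div_iff_of_neg hd]; linarith
    · rw [div_le_iff_of_neg hd]; linarith

theorem x_succ (t : ℕ) (i : Fin n) :
    P.x (t + 1) i = P.x t i + ∑ j, P.weight t i j * (P.x t j - P.x t i) := by
  rw [P.hx (t + 1) (by omega) i]
  change P.x t i + 1 / ((t + 1 : ℕ) : ℝ) ^ P.β * ∑ j ∈ P.S (t + 1) i, _ = _
  have hpos : 0 < ((t + 1 : ℕ) : ℝ) ^ P.β := Real.rpow_pos_of_pos (by positivity) _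
  simp only [weight, ite_mul, zero_mul]
  rw [Finset.sum_ite_mem, Finset.univ_inter, Finset.mul_sum]
  congr 1
  refine Finset.sum_congr rfl fun j hj => ?_
  have hd := (P.ratio_bounds_of_mem_S hj).1
  have hD := P.one_le_D (P.mem_S.1 hj).1
  have hD' : P.D i j (t + 1) ≠ 0 := by linarith
  field_simp

theorem weight_symm (t : ℕ) (i j : Fin n) : P.weight t i j = P.weight t j i := by
  unfold weight
  by_cases h : j ∈ P.S (t + 1) i
  · rw [if_pos h, if_pos (P.mem_S_comm.1 h), P.Dsymm i j, P.xin_eq_xout_swap,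
      P.xin_eq_xout_swap, ← neg_sub (P.xout _ i j), ← neg_sub (P.x t i), neg_div_neg_eq]
  · rw [if_neg h, if_neg (fun h' => h (P.mem_S_comm.1 h'))]

theorem weight_nonneg (t : ℕ) (i j : Fin n) : 0 ≤ P.weight t i j := by
  unfold weight
  split_ifs with h
  · have := (P.ratio_bounds_of_mem_S h).2.1
    have hD := P.one_le_D (P.mem_S.1 h).1
    exact div_nonneg (by linarith) (mul_nonneg (by linarith) (Real.rpow_nonneg (by positivity) _))
  · rfl

theorem le_weight_of_mem_S {t : ℕ} {i j : Fin n} (h : j ∈ P.S (t + 1) i) :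
    1 / (6 * P.D i j (t + 1) * ((t + 1 : ℕ) : ℝ) ^ P.β) ≤ P.weight t i j := by
  have hpos : 0 < ((t + 1 : ℕ) : ℝ) ^ P.β := Real.rpow_pos_of_pos (by positivity) _
  have hD := P.one_le_D (P.mem_S.1 h).1
  have hD' : 0 < P.D i j (t + 1) := by linarith
  rw [weight, if_pos h]
  refine le_trans (le_of_eq ?_)
    (div_le_div_of_nonneg_right (P.ratio_bounds_of_mem_S h).2.1 (by positivity))
  field_simp
  norm_num

theorem sum_weight_le (t : ℕ) (i : Fin n) :
    ∑ j, P.weight t i j ≤ 1 / (2 * ((t + 1 : ℕ) : ℝ) ^ P.β) := by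
  have hpos : 0 < ((t + 1 : ℕ) : ℝ) ^ P.β := Real.rpow_pos_of_pos (by positivity) _
  simp only [weight]
  rw [Finset.sum_ite_mem, Finset.univ_inter]
  rcases (P.S (t + 1) i).eq_empty_or_nonempty with he | hne
  · rw [he, Finset.sum_empty]; positivity
  have hcard : 0 < ((P.S (t + 1) i).card : ℝ) := by exact_mod_cast hne.card_pos
  calc _ ≤ ∑ j ∈ P.S (t + 1) i,
        2 / (4 * ((P.S (t + 1) i).card : ℝ) * ((t + 1 : ℕ) : ℝ) ^ P.β) := by
        refine Finset.sum_le_sum fun j hj => ?_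
        have := P.card_S_le_D hj
        exact div_le_div₀ (by norm_num) (P.ratio_bounds_of_mem_S hj).2.2 (by positivity)
          (by gcongr)
    _ = _ := by
        rw [Finset.sum_const, nsmul_eq_mul]
        field_simp
        norm_num

theorem sum_weight_le_half (t : ℕ) (i : Fin n) : ∑ j, P.weight t i j ≤ 1 / 2 := by
  refine (P.sum_weight_le t i).trans ?_
  have : 1 ≤ ((t + 1 : ℕ) : ℝ) ^ P.β :=
    Real.one_le_rpow (by simp) (P.hα.trans P.hαβ).le
  exact one_div_le_one_div_of_le (by norm_num) (by linarith)

theorem sqDev_succ_le (t : ℕ) (i j : Fin n) :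
    sqDev (P.x (t + 1)) + 1 / 2 * (P.weight t i j * (P.x t j - P.x t i) ^ 2)
      ≤ sqDev (P.x t) := by
  refine le_trans ?_ (sqDev_averaging_le (P.x t) (P.x (t + 1)) (P.weight t) (P.weight_symm t)
    (P.weight_nonneg t) (P.sum_weight_le_half t) (P.x_succ t))
  have h0 : ∀ i j, 0 ≤ P.weight t i j * (P.x t j - P.x t i) ^ 2 :=
    fun i j => mul_nonneg (P.weight_nonneg t i j) (sq_nonneg _)
  have h1 := Finset.single_le_sum (f := fun j => P.weight t i j * (P.x t j - P.x t i) ^ 2)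
    (fun j _ => h0 i j) (Finset.mem_univ j)
  have h2 := Finset.single_le_sum (f := fun i => ∑ j, P.weight t i j * (P.x t j - P.x t i) ^ 2)
    (fun i _ => Finset.sum_nonneg fun j _ => h0 i j) (Finset.mem_univ i)
  linarith

theorem sqDev_antitone : Antitone fun t => sqDev (P.x t) := by
  refine antitone_nat_of_succ_le fun t => ?_
  by_cases hn : n = 0
  · subst hn; simp [sqDev]
  · have i : Fin n := ⟨0, Nat.pos_of_ne_zero hn⟩
    simpa using P.sqDev_succ_le t i i

theorem x_mem_Icc (t : ℕ) (i : Fin n) : P.x t i ∈ Set.Icc (minV (P.x 0)) (maxV (P.x 0)) := by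
  induction t generalizing i with
  | zero =>
    exact ⟨ciInf_le (Set.finite_range _).bddBelow i, le_ciSup (Set.finite_range _).bddAbove i⟩
  | succ t ih =>
    rw [P.x_succ]
    exact averaging_mem_Icc (P.weight_nonneg t i) (P.sum_weight_le_half t i) ih

theorem abs_x_le (t : ℕ) (i : Fin n) : |P.x t i| ≤ normInf (P.x 0) := by
  rw [abs_le]
  change P.x t i ∈ Set.Icc _ _
  induction t generalizing i with
  | zero =>
    exact abs_le.1 (le_ciSup (f := fun i => |P.x 0 i|) (Set.finite_range _).bddAbove i)
  | succ t ih =>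
    rw [P.x_succ]
    exact averaging_mem_Icc (P.weight_nonneg t i) (P.sum_weight_le_half t i) ih

theorem abs_x_succ_sub_le (t : ℕ) (i : Fin n) :
    |P.x (t + 1) i - P.x t i| ≤ Wsp (P.x 0) / (2 * ((t + 1 : ℕ) : ℝ) ^ P.β) := by
  rw [P.x_succ, add_sub_cancel_left]
  have hW : ∀ j, |P.x t j - P.x t i| ≤ Wsp (P.x 0) := by
    intro j
    have hi := P.x_mem_Icc t i
    have hj := P.x_mem_Icc t j
    rw [abs_le]; unfold Wsp
    constructor <;> linarith [hi.1, hi.2, hj.1, hj.2]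
  have hW0 : 0 ≤ Wsp (P.x 0) := (abs_nonneg _).trans (hW i)
  calc _ ≤ ∑ j, P.weight t i j * Wsp (P.x 0) := by
        refine (Finset.abs_sum_le_sum_abs _ _).trans (Finset.sum_le_sum fun j _ => ?_)
        rw [abs_mul, abs_of_nonneg (P.weight_nonneg t i j)]
        exact mul_le_mul_of_nonneg_left (hW j) (P.weight_nonneg t i j)
    _ ≤ _ := by
        rw [← Finset.sum_mul]
        refine (mul_le_mul_of_nonneg_right (P.sum_weight_le t i) hW0).trans (le_of_eq ?_)
        ring

theorem abs_xout_le (t : ℕ) (i j : Fin n) : |P.xout t i j| ≤ normInf (P.x 0) := by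
  induction t with
  | zero =>
    rw [P.hxout0, abs_zero]
    exact (abs_nonneg _).trans (P.abs_x_le 0 i)
  | succ t ih =>
    by_cases h : P.E (t + 1) i j
    · rw [P.hxoutE _ (by omega) _ _ h, P.hq _ (by omega) _ _ h]
      have hpos : 0 < ((t + 1 : ℕ) : ℝ) ^ P.α := Real.rpow_pos_of_pos (by positivity) _
      have hx := abs_le.1 (P.abs_x_le t i)
      have ho := abs_le.1 ih
      simp only [Nat.add_sub_cancel]
      set s := ((t + 1 : ℕ) : ℝ) ^ P.α
      unfold Rq
      have h1 : 0 < 1 / s := by positivity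
      rw [abs_le]
      split_ifs with h2 h3
      · have : 1 / s < P.x t i - P.xout t i j := by rwa [div_lt_iff₀' hpos]
        constructor <;> linarith
      · have : 1 / s < -(P.x t i - P.xout t i j) := by rw [div_lt_iff₀' hpos]; linarith
        rw [neg_div]
        constructor <;> linarith
      · simpa using ho
    · rw [P.hxoutN _ (by omega) _ _ h]; exact ih

variable {P}

theorem abs_x_add_sub_le {t : ℕ} {i : Fin n} {δ : ℝ}
    (hδ : ∀ r, t ≤ r → |P.x (r + 1) i - P.x r i| ≤ δ) (m : ℕ) :
    |P.x (t + m) i - P.x t i| ≤ m * δ := by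
  induction m with
  | zero => simp
  | succ m ih =>
    have h := abs_sub_le (P.x (t + m + 1) i) (P.x (t + m) i) (P.x t i)
    have := hδ (t + m) (by omega)
    push_cast
    rw [← add_assoc]
    linarith

theorem abs_err_succ_le {t : ℕ} {i j : Fin n} {δ : ℝ} (hδ : |P.x (t + 1) i - P.x t i| ≤ δ) :
    |P.err (t + 1) i j| ≤ |P.x t i - P.xout (t + 1) i j| + δ := by
  have h := abs_sub_le (P.x (t + 1) i) (P.x t i) (P.xout (t + 1) i j)
  unfold err
  linarith

theorem abs_err_le {t s : ℕ} {i j : Fin n} {δ : ℝ}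
    (hδ : ∀ r, t ≤ r → |P.x (r + 1) i - P.x r i| ≤ δ) (hs : t ≤ s) :
    |P.err s i j| ≤ |P.err t i j| + ((s : ℝ) - t) * δ := by
  induction s, hs using Nat.le_induction with
  | base => simp
  | succ s hs ih =>
    have h1 := abs_err_succ_le (j := j) (hδ s hs)
    have h2 := P.abs_sub_xout_succ_le s i j
    push_cast
    linarith

/-- When the edge carries a message, afterwards either the error is at most one quantum, or it has
been reduced by one quantum, up to drift. -/
theorem abs_err_le_of_edge {t s T : ℕ} {i j : Fin n} {δ : ℝ}
    (hδ : ∀ r, t ≤ r → |P.x (r + 1) i - P.x r i| ≤ δ) (hs : t ≤ s) (hT : s + 1 ≤ T)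
    (hE : P.E (s + 1) i j) :
    (P.q (s + 1) i j = 0 →
      |P.err T i j| ≤ 1 / ((s + 1 : ℕ) : ℝ) ^ P.α + ((T : ℝ) - t) * δ) ∧
    (P.q (s + 1) i j ≠ 0 →
      |P.err T i j| ≤ |P.err t i j| + ((T : ℝ) - t) * δ - 1 / ((s + 1 : ℕ) : ℝ) ^ P.α) := by
  have h1 := abs_err_le (j := j) hδ hs
  have h2 := abs_err_succ_le (j := j) (hδ s hs)
  have h3 := abs_err_le (j := j) (fun r hr => hδ r (by omega)) hT
  have hδ0 : 0 ≤ δ := (abs_nonneg _).trans (hδ t le_rfl)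
  have hst : (t : ℝ) ≤ s := by exact_mod_cast hs
  push_cast at h3
  constructor
  · intro hq
    have h4 := (P.q_eq_zero_iff hE).1 hq
    rw [P.xout_succ_of_q_eq_zero hE hq] at h2
    unfold err at *
    nlinarith
  · intro hq
    rw [P.abs_sub_xout_succ_of_q_ne_zero hE hq] at h2
    linarith

theorem quantum_pos {r : ℕ} (hr : 0 < r) (α : ℝ) : 0 < 1 / (r : ℝ) ^ α :=
  one_div_pos.2 (Real.rpow_pos_of_pos (by exact_mod_cast hr) _)

theorem quantum_anti (P : Protocol n) {r s : ℕ} (hr : 0 < r) (hrs : r ≤ s) :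
    1 / (s : ℝ) ^ P.α ≤ 1 / (r : ℝ) ^ P.α := by
  have hr' : 0 < (r : ℝ) := by exact_mod_cast hr
  exact one_div_le_one_div_of_le (Real.rpow_pos_of_pos hr' _)
    (Real.rpow_le_rpow hr'.le (by exact_mod_cast hrs) P.hα.le)

theorem quantum_ratio (P : Protocol n) {r s : ℕ} (hr : 0 < r) (hrs : r ≤ s) :
    (r : ℝ) / s * (1 / (r : ℝ) ^ P.α) ≤ 1 / (s : ℝ) ^ P.α := by
  have hr' : 0 < (r : ℝ) := by exact_mod_cast hr
  have hs' : 0 < (s : ℝ) := by exact_mod_cast hr.trans_le hrs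
  have h : (r : ℝ) / s ≤ ((r : ℝ) / s) ^ P.α := by
    refine Real.self_le_rpow_of_le_one (by positivity) ?_ (P.hαβ.trans P.hβ).le
    rw [div_le_one hs']; exact_mod_cast hrs
  rw [Real.div_rpow hr'.le hs'.le] at h
  have := Real.rpow_pos_of_pos hr' P.α
  have := Real.rpow_pos_of_pos hs' P.α
  calc _ ≤ (r : ℝ) ^ P.α / (s : ℝ) ^ P.α * (1 / (r : ℝ) ^ P.α) := by gcongr
    _ = _ := by field_simp

theorem abs_x_succ_sub_le_of_le {t r : ℕ} (ht : 0 < t) (hr : t ≤ r) (i : Fin n) :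
    |P.x (r + 1) i - P.x r i| ≤ Wsp (P.x 0) / (2 * (t : ℝ) ^ P.β) := by
  refine (P.abs_x_succ_sub_le r i).trans ?_
  have hW : 0 ≤ Wsp (P.x 0) :=
    sub_nonneg.2 ((P.x_mem_Icc 0 i).1.trans (P.x_mem_Icc 0 i).2)
  have : 0 < (t : ℝ) ^ P.β := Real.rpow_pos_of_pos (by exact_mod_cast ht) _
  have : (t : ℝ) ^ P.β ≤ ((r + 1 : ℕ) : ℝ) ^ P.β :=
    Real.rpow_le_rpow (by positivity) (by exact_mod_cast (by omega)) (P.hα.trans P.hαβ).le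
  gcongr

/-- Along an edge present in every window of length `B`, starting from a time at which drift is
small, the error either is of the order of one quantum, or has been decreasing linearly. -/
theorem err_tracking {B : ℕ} (hB : 0 < B) {i j : Fin n}
    (hfire : ∀ k, ∃ s, k * B ≤ s ∧ s + 1 ≤ (k + 1) * B ∧ P.E (s + 1) i j)
    {k₀ : ℕ} (hk₀ : 32 ≤ k₀)
    (hdrift : ∀ k, k₀ ≤ k → B * (Wsp (P.x 0) / (2 * ((k * B : ℕ) : ℝ) ^ P.β))
      ≤ 1 / ((k * B : ℕ) : ℝ) ^ P.α / 16)
    (K m : ℕ) (hm : k₀ + m ≤ K) :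
    |P.err ((k₀ + m) * B) i j| ≤ 3 / 2 * (1 / (((k₀ + m) * B : ℕ) : ℝ) ^ P.α) ∨
    |P.err ((k₀ + m) * B) i j| ≤
      2 * normInf (P.x 0) - m * (1 / 2 * (1 / ((K * B : ℕ) : ℝ) ^ P.α)) := by
  induction m with
  | zero =>
    right
    have h := abs_sub (P.x ((k₀ + 0) * B) i) (P.xout ((k₀ + 0) * B) i j)
    have h1 := P.abs_x_le ((k₀ + 0) * B) i
    have h2 := P.abs_xout_le ((k₀ + 0) * B) i j
    unfold err
    push_cast
    linarith
  | succ m ih =>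
    specialize ih (by omega)
    have hdr := hdrift (k₀ + m) (by omega)
    obtain ⟨s, hs1, hs2, hE⟩ := hfire (k₀ + m)
    rw [← add_assoc]
    set k := k₀ + m with hk
    have hkB : 0 < k * B := Nat.mul_pos (by omega) hB
    have key := abs_err_le_of_edge (P := P) (fun r hr => abs_x_succ_sub_le_of_le hkB hr i)
      hs1 hs2 hE
    have hlen : (((k + 1) * B : ℕ) : ℝ) - ((k * B : ℕ) : ℝ) = B := by push_cast; ring
    rw [hlen] at key
    have hr1 := quantum_ratio P hkB (show k * B ≤ (k + 1) * B by nlinarith)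
    have hr2 : (32 : ℝ) / 33 ≤ ((k * B : ℕ) : ℝ) / (((k + 1) * B : ℕ) : ℝ) := by
      have hk' : (32 : ℝ) ≤ k := by exact_mod_cast (by omega)
      have hB' : (0 : ℝ) < B := by exact_mod_cast hB
      push_cast
      rw [mul_div_mul_right _ _ hB'.ne', div_le_div_iff₀ (by norm_num) (by linarith)]
      linarith
    have hp0 := quantum_pos hkB P.α
    have hr3 := (mul_le_mul_of_nonneg_right hr2 hp0.le).trans hr1
    have ha1 := quantum_anti P hkB (show k * B ≤ s + 1 by omega)
    have ha2 := quantum_anti P (show 0 < s + 1 by omega) hs2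
    have ha3 := quantum_anti P (show 0 < s + 1 by omega)
      (show s + 1 ≤ K * B from hs2.trans (Nat.mul_le_mul_right _ (by omega)))
    set a0 := 1 / ((k * B : ℕ) : ℝ) ^ P.α
    set a1 := 1 / (((k + 1) * B : ℕ) : ℝ) ^ P.α
    set as := 1 / ((s + 1 : ℕ) : ℝ) ^ P.α
    set aK := 1 / ((K * B : ℕ) : ℝ) ^ P.α
    by_cases hq : P.q (s + 1) i j = 0
    · left
      have := key.1 hq
      linarith
    · have := key.2 hq
      rcases ih with ih | ih
      · left; linarith
      · right; push_cast; linarith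

/-- If both endpoints of an edge are tracked well at time `t`, and the edge is present in three
consecutive windows, then at one of these occasions neither endpoint needs to send a correction. -/
theorem exists_both_q_eq_zero {B t : ℕ} {i j : Fin n} {δ : ℝ} (ht : 128 * B ≤ t) (hB : 0 < B)
    (hfire : ∀ l < 3, ∃ s, t + l * B ≤ s ∧ s + 1 ≤ t + (l + 1) * B ∧ P.E (s + 1) i j)
    (hδ : ∀ r, t ≤ r → ∀ i, |P.x (r + 1) i - P.x r i| ≤ δ)
    (hδB : B * δ ≤ 1 / (t : ℝ) ^ P.α / 16)
    (hi : |P.err t i j| ≤ 3 / 2 * (1 / (t : ℝ) ^ P.α))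
    (hj : |P.err t j i| ≤ 3 / 2 * (1 / (t : ℝ) ^ P.α)) :
    ∃ s, t ≤ s ∧ s + 1 ≤ t + 3 * B ∧ P.E (s + 1) i j ∧
      P.q (s + 1) i j = 0 ∧ P.q (s + 1) j i = 0 := by
  have hδ0 : 0 ≤ δ := (abs_nonneg _).trans (hδ t le_rfl i)
  have htpos : 0 < t := by omega
  have hquant : ∀ r, t ≤ r → r ≤ t + 3 * B →
      128 / 131 * (1 / (t : ℝ) ^ P.α) ≤ 1 / (r : ℝ) ^ P.α := by
    intro r h1 h2
    refine le_trans (mul_le_mul_of_nonneg_right ?_ (quantum_pos htpos _).le)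
      (quantum_ratio P htpos h1)
    rw [div_le_div_iff₀ (by norm_num) (by exact_mod_cast (by omega))]
    exact_mod_cast (by omega)
  have once : ∀ i j, |P.err t i j| ≤ 3 / 2 * (1 / (t : ℝ) ^ P.α) → ∀ s s', t ≤ s → s < s' →
      s' + 1 ≤ t + 3 * B → P.E (s + 1) i j → P.E (s' + 1) i j → P.q (s + 1) i j ≠ 0 →
      P.q (s' + 1) i j = 0 := by
    intro i j he s s' h1 h2 h3 hE hE' hq
    rw [P.q_eq_zero_iff hE']
    have h4 := (abs_err_le_of_edge (fun r hr => hδ r hr i) h1 h2 hE).2 hq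
    have h5 := hquant (s + 1) (by omega) (by omega)
    have h6 := hquant (s' + 1) (by omega) (by omega)
    have h7 : ((s' : ℝ) - t) * δ ≤ 3 * (B * δ) := by
      rw [← mul_assoc]
      refine mul_le_mul_of_nonneg_right ?_ hδ0
      have : (s' : ℝ) ≤ t + 3 * B := by exact_mod_cast (by omega)
      linarith
    have := quantum_pos htpos P.α
    linarith
  obtain ⟨s0, h01, h02, hE0⟩ := hfire 0 (by norm_num)
  obtain ⟨s1, h11, h12, hE1⟩ := hfire 1 (by norm_num)
  obtain ⟨s2, h21, h22, hE2⟩ := hfire 2 (by norm_num)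
  by_contra! hcon
  have c0 := hcon s0 (by omega) (by omega) hE0
  have c1 := hcon s1 (by omega) (by omega) hE1
  have c2 := hcon s2 (by omega) (by omega) hE2
  have i01 := once i j hi s0 s1 (by omega) (by omega) (by omega) hE0 hE1
  have i02 := once i j hi s0 s2 (by omega) (by omega) (by omega) hE0 hE2
  have i12 := once i j hi s1 s2 (by omega) (by omega) (by omega) hE1 hE2
  have j01 := once j i hj s0 s1 (by omega) (by omega) (by omega) (P.Esymm _ _ _ hE0)
    (P.Esymm _ _ _ hE1)
  have j02 := once j i hj s0 s2 (by omega) (by omega) (by omega) (P.Esymm _ _ _ hE0)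
    (P.Esymm _ _ _ hE2)
  have j12 := once j i hj s1 s2 (by omega) (by omega) (by omega) (P.Esymm _ _ _ hE1)
    (P.Esymm _ _ _ hE2)
  by_cases h0 : P.q (s0 + 1) i j = 0
  · exact c2 (i12 fun h1 => c1 h1 (j01 (c0 h0))) (j02 (c0 h0))
  · exact c2 (i02 h0) (j12 (c1 (i01 h0)))

/-- An edge whose endpoint values differ by at least eight quanta takes part in an averaging step
within three windows, which decreases the squared deviation accordingly. -/
theorem sqDev_decrease_of_edge {B t : ℕ} {i j : Fin n} {δ Dsup : ℝ} (ht : 128 * B ≤ t) (hB : 0 < B)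
    (hDsup : ∀ t i j, P.E t i j → P.D i j t ≤ Dsup)
    (hfire : ∀ l < 3, ∃ s, t + l * B ≤ s ∧ s + 1 ≤ t + (l + 1) * B ∧ P.E (s + 1) i j)
    (hδ : ∀ r, t ≤ r → ∀ i, |P.x (r + 1) i - P.x r i| ≤ δ)
    (hδB : B * δ ≤ 1 / (t : ℝ) ^ P.α / 16)
    (hi : |P.err t i j| ≤ 3 / 2 * (1 / (t : ℝ) ^ P.α))
    (hj : |P.err t j i| ≤ 3 / 2 * (1 / (t : ℝ) ^ P.α))
    (hgap : 8 * (1 / (t : ℝ) ^ P.α) ≤ |P.x t i - P.x t j|) :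
    1 ≤ Dsup ∧ sqDev (P.x (t + 3 * B)) +
      1 / (25 * (Dsup * ((t : ℝ) + 3 * B) ^ P.β)) * (P.x t i - P.x t j) ^ 2 ≤ sqDev (P.x t) := by
  obtain ⟨s, hs1, hs2, hE, hq1, hq2⟩ := exists_both_q_eq_zero ht hB hfire hδ hδB hi hj
  have hE' := P.Esymm _ _ _ hE
  have htpos : 0 < t := by omega
  have hδ0 : 0 ≤ δ := (abs_nonneg _).trans (hδ t le_rfl i)
  have hdrift : ∀ i, |P.x s i - P.x t i| ≤ 3 / 16 * (1 / (t : ℝ) ^ P.α) := by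
    intro i
    have h := abs_x_add_sub_le (fun r hr => hδ r hr i) (s - t)
    rw [Nat.add_sub_cancel' hs1] at h
    have h2 : ((s - t : ℕ) : ℝ) * δ ≤ (3 * B) * δ :=
      mul_le_mul_of_nonneg_right (by exact_mod_cast (by omega)) hδ0
    linarith
  have e1 := (P.q_eq_zero_iff hE).1 hq1
  have e2 := (P.q_eq_zero_iff hE').1 hq2
  have hanti := quantum_anti P htpos (show t ≤ s + 1 by omega)
  have hpos := quantum_pos (show 0 < s + 1 by omega) P.α
  have di := hdrift i
  have dj := hdrift j
  have hgap' : 61 / 64 * |P.x t i - P.x t j| ≤ |P.x s j - P.x s i| := by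
    have h1 := abs_sub_le (P.x t i) (P.x s i) (P.x t j)
    have h2 := abs_sub_le (P.x s i) (P.x s j) (P.x t j)
    rw [abs_sub_comm (P.x t i) (P.x s i)] at h1
    rw [abs_sub_comm (P.x s i) (P.x s j)] at h2
    linarith
  have hmem : j ∈ P.S (s + 1) i := by
    refine P.mem_S.2 ⟨hE, ?_, hq2, hq1⟩
    rw [P.xin_eq_xout_swap, P.xout_succ_of_q_eq_zero hE hq1, P.xout_succ_of_q_eq_zero hE' hq2]
    unfold err at e1 e2
    have h1 := abs_sub_le (P.x s j) (P.xout s j i) (P.x s i)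
    have h2 := abs_sub_le (P.xout s j i) (P.xout s i j) (P.x s i)
    rw [abs_sub_comm (P.xout s i j) (P.x s i)] at h2
    rw [show 4 / ((s + 1 : ℕ) : ℝ) ^ P.α = 4 * (1 / ((s + 1 : ℕ) : ℝ) ^ P.α) by ring]
    linarith
  have hD1 := P.one_le_D hE
  have hD2 := hDsup _ _ _ hE
  refine ⟨hD1.trans hD2, ?_⟩
  have hw := P.le_weight_of_mem_S hmem
  have hb0 : 0 < ((s + 1 : ℕ) : ℝ) ^ P.β := Real.rpow_pos_of_pos (by positivity) _
  have hb : ((s + 1 : ℕ) : ℝ) ^ P.β ≤ ((t : ℝ) + 3 * B) ^ P.β :=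
    Real.rpow_le_rpow (by positivity) (by exact_mod_cast hs2) (P.hα.trans P.hαβ).le
  set T := ((t : ℝ) + 3 * B) ^ P.β
  have hDT : 0 < Dsup * T := mul_pos (by linarith) (by linarith)
  have hw2 : 1 / 6 * (1 / (Dsup * T)) ≤ P.weight s i j := by
    refine le_trans (le_trans (le_of_eq ?_) (one_div_le_one_div_of_le (by positivity)
      (show 6 * P.D i j (s + 1) * ((s + 1 : ℕ) : ℝ) ^ P.β ≤ 6 * (Dsup * T) from ?_))) hw
    · field_simp
    · rw [mul_assoc]
      have : 0 ≤ Dsup := by linarith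
      gcongr
  have hsq : (61 / 64) ^ 2 * (P.x t i - P.x t j) ^ 2 ≤ (P.x s j - P.x s i) ^ 2 := by
    have := pow_le_pow_left₀ (by positivity) hgap' 2
    rwa [mul_pow, sq_abs, sq_abs] at this
  have hstep := P.sqDev_succ_le s i j
  have hm1 := P.sqDev_antitone hs1
  have hm2 := P.sqDev_antitone hs2
  simp only at hm1 hm2
  have hprod := mul_le_mul hw2 hsq (by positivity) (P.weight_nonneg s i j)
  have h0 : 0 ≤ 1 / (Dsup * T) * (P.x t i - P.x t j) ^ 2 := by positivity
  have : 1 / (25 * (Dsup * T)) * (P.x t i - P.x t j) ^ 2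
      = 1 / 25 * (1 / (Dsup * T) * (P.x t i - P.x t j) ^ 2) := by field_simp
  rw [this]
  nlinarith

end Protocol

theorem V2_sq {n : ℕ} (y : Fin n → ℝ) : V2 y ^ 2 = sqDev y :=
  Real.sq_sqrt (sqDev_nonneg y)

/-- The lower bound on `t` yields a time `T₀ ≤ t / 4` after which drift is small, and shows that
there is enough time left for the estimates to catch up. -/
theorem threshold_consequences {α β : ℝ} (hα : 0 < α) (hαβ : α < β) (hβ : β < 1)
    {B W X t : ℝ} (hB : 1 ≤ B) (hW : 0 ≤ W) (hX : 0 ≤ X)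
    (ht : (2 : ℝ) ^ ((2 : ℝ) / (1 - α)) * ((⌈32 * B + 8 * B * W⌉ : ℝ)) ^ ((1 : ℝ) / (β - α)) +
        (32 * B * X) ^ ((2 : ℝ) / (1 - α)) ≤ t) :
    ∃ T₀ : ℝ, 32 * B ≤ T₀ ∧ 4 * T₀ ≤ t ∧ 32 * B * X ≤ t ^ (1 - α) ∧
      ∀ r, T₀ ≤ r → B * (W / (2 * r ^ β)) ≤ 1 / r ^ α / 16 := by
  have hN := Int.le_ceil (32 * B + 8 * B * W)
  set N : ℝ := (⌈32 * B + 8 * B * W⌉ : ℝ)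
  have hBW : 0 ≤ B * W := by positivity
  have hN1 : 1 ≤ N := by linarith
  have hba : 0 < β - α := by linarith
  have h1a : 0 < 1 - α := by linarith
  have hT : N ≤ N ^ ((1 : ℝ) / (β - α)) :=
    Real.self_le_rpow_of_one_le hN1 (by rw [le_div_iff₀ hba]; linarith)
  have hpow : (N ^ ((1 : ℝ) / (β - α))) ^ (β - α) = N := by
    rw [← Real.rpow_mul (by linarith), one_div_mul_cancel hba.ne', Real.rpow_one]
  have h4 : (4 : ℝ) ≤ (2 : ℝ) ^ ((2 : ℝ) / (1 - α)) := by
    have : (2 : ℝ) ^ (2 : ℝ) ≤ (2 : ℝ) ^ ((2 : ℝ) / (1 - α)) :=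
      Real.rpow_le_rpow_of_exponent_le (by norm_num) (by rw [le_div_iff₀ h1a]; linarith)
    norm_num at this ⊢; linarith
  have hX' : 0 ≤ 32 * B * X := by positivity
  have hX2 : 0 ≤ (32 * B * X) ^ ((2 : ℝ) / (1 - α)) := Real.rpow_nonneg hX' _
  set T₀ := N ^ ((1 : ℝ) / (β - α))
  have h4T : 4 * T₀ ≤ t :=
    (mul_le_mul_of_nonneg_right h4 (by linarith)).trans (by linarith)
  have hT0 : 0 < T₀ := by linarith
  have hXt : (32 * B * X) ^ ((2 : ℝ) / (1 - α)) ≤ t := by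
    have : 0 ≤ (2 : ℝ) ^ ((2 : ℝ) / (1 - α)) * T₀ := by positivity
    linarith
  refine ⟨T₀, by linarith, h4T, ?_, ?_⟩
  · by_cases h1 : 32 * B * X ≤ 1
    · exact h1.trans (Real.one_le_rpow (by linarith) h1a.le)
    · have h := Real.rpow_le_rpow hX2 hXt h1a.le
      rw [← Real.rpow_mul hX', div_mul_cancel₀ _ h1a.ne', Real.rpow_two] at h
      nlinarith
  · intro r hr
    have hr0 : 0 < r := by linarith
    have h1 : N ≤ r ^ (β - α) := by
      rw [← hpow]; exact Real.rpow_le_rpow hT0.le hr hba.le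
    have h2 : r ^ β = r ^ (β - α) * r ^ α := by rw [← Real.rpow_add hr0]; ring_nf
    have h3 : 0 < r ^ α := Real.rpow_pos_of_pos hr0 _
    have h5 : 0 < r ^ (β - α) := Real.rpow_pos_of_pos hr0 _
    rw [h2, div_div, ← mul_div_assoc, div_le_div_iff₀ (by positivity) (by positivity)]
    have : 8 * (B * W) * r ^ α ≤ r ^ (β - α) * r ^ α :=
      mul_le_mul_of_nonneg_right (by linarith) h3.le
    linarith

/-- if `V2(t)` is not too small at a late enough multiple `t` of `B`, then
it contracts by a factor `1 - 1/(50 n³ D (t+3B)^β)` over the next `3B` steps. -/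
theorem stmt13_variance_contracts {n : ℕ} (hn : 1 ≤ n) (P : Protocol n)
    (B : ℕ) (hB : 0 < B) (Einf : Fin n → Fin n → Prop)
    (hcore : P.CoreConnected B Einf)
    (Dsup : ℝ) (hDsup : ∀ t i j, P.E t i j → P.D i j t ≤ Dsup)
    (t : ℕ) (hmul : B ∣ t)
    (ht : (2 : ℝ) ^ ((2 : ℝ) / (1 - P.α)) *
        ((⌈32 * (B : ℝ) + 8 * B * Wsp (P.x 0)⌉ : ℝ)) ^ ((1 : ℝ) / (P.β - P.α)) +
        (32 * B * normInf (P.x 0)) ^ ((2 : ℝ) / (1 - P.α)) ≤ (t : ℝ))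
    (hV : 8 * (n : ℝ) ^ (1.5 : ℝ) / (t : ℝ) ^ P.α ≤ V2 (P.x t)) :
    V2 (P.x (t + 3 * B)) ≤
      (1 - 1 / (50 * (n : ℝ) ^ 3 * Dsup * ((t : ℝ) + 3 * B) ^ P.β)) * V2 (P.x t) := by
  obtain ⟨K, rfl⟩ := hmul
  have hB' : (1 : ℝ) ≤ B := by exact_mod_cast hB
  have i₀ : Fin n := ⟨0, hn⟩
  have hX : 0 ≤ normInf (P.x 0) := (abs_nonneg _).trans (P.abs_x_le 0 i₀)
  have hW : 0 ≤ Wsp (P.x 0) :=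
    sub_nonneg.2 ((P.x_mem_Icc 0 i₀).1.trans (P.x_mem_Icc 0 i₀).2)
  obtain ⟨T₀, hT32, hT4, hTX, hTdrift⟩ :=
    threshold_consequences P.hα P.hαβ P.hβ hB' hW hX ht
  rw [mul_comm B K] at *
  set k₀ := ⌈T₀ / B⌉₊
  have hB0 : (0 : ℝ) < B := by linarith
  have hk₀T : T₀ ≤ k₀ * B := by
    rw [← div_le_iff₀ hB0]; exact Nat.le_ceil _
  have hk₀lt : (k₀ : ℝ) * B < T₀ + B := by
    have h := Nat.ceil_lt_add_one (show 0 ≤ T₀ / B from div_nonneg (by linarith) hB0.le)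
    have := mul_lt_mul_of_pos_right h hB0
    rwa [add_mul, one_mul, div_mul_cancel₀ _ hB0.ne'] at this
  have hk₀ : 32 ≤ k₀ := by
    have : (32 : ℝ) ≤ k₀ := (show (32 : ℝ) ≤ T₀ / B by rwa [le_div_iff₀ hB0]).trans
      (Nat.le_ceil _)
    exact_mod_cast this
  have ht128 : 128 * B ≤ K * B := by
    have : 128 * (B : ℝ) ≤ ((K * B : ℕ) : ℝ) := by linarith
    exact_mod_cast this
  have htpos : 0 < K * B := by omega
  have ht0 : (0 : ℝ) < ((K * B : ℕ) : ℝ) := by exact_mod_cast htpos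
  have hhalf : ((K * B : ℕ) : ℝ) / 2 ≤ ((K : ℝ) - k₀) * B := by
    push_cast at hT4 ⊢
    linarith
  have hk₀K : k₀ ≤ K := by
    have : 0 < ((K : ℝ) - k₀) * B := lt_of_lt_of_le (by positivity) hhalf
    have := pos_of_mul_pos_left this hB0.le
    exact_mod_cast (sub_pos.1 this).le
  have hdrift : ∀ k, k₀ ≤ k → B * (Wsp (P.x 0) / (2 * ((k * B : ℕ) : ℝ) ^ P.β))
      ≤ 1 / ((k * B : ℕ) : ℝ) ^ P.α / 16 := by
    intro k hk
    refine hTdrift _ (hk₀T.trans ?_)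
    exact_mod_cast Nat.mul_le_mul_right B hk
  have hquant := Protocol.quantum_pos htpos P.α
  have htrack : ∀ i j, (∀ k, ∃ s, k * B ≤ s ∧ s + 1 ≤ (k + 1) * B ∧ P.E (s + 1) i j) →
      |P.err (K * B) i j| ≤ 3 / 2 * (1 / ((K * B : ℕ) : ℝ) ^ P.α) := by
    intro i j hfire
    have h := Protocol.err_tracking hB hfire hk₀ hdrift K (K - k₀) (by omega)
    rw [Nat.add_sub_cancel' hk₀K, Nat.cast_sub hk₀K] at h
    refine h.resolve_right fun hneg => ?_
    have hpow : ((K * B : ℕ) : ℝ) ^ (1 - P.α)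
        = ((K * B : ℕ) : ℝ) * (1 / ((K * B : ℕ) : ℝ) ^ P.α) := by
      rw [Real.rpow_sub ht0, Real.rpow_one]; ring
    rw [hpow] at hTX
    have h1 := mul_le_mul_of_nonneg_right hhalf hquant.le
    have h2 := mul_pos ht0 hquant
    set a := 1 / ((K * B : ℕ) : ℝ) ^ P.α
    have h3 : 16 * normInf (P.x 0) * B ≤ ((K : ℝ) - k₀) * a * B := by linarith
    have h4 := le_of_mul_le_mul_right h3 hB0
    have h5 : 0 < ((K : ℝ) - k₀) * a * B := by linarith
    have h6 := pos_of_mul_pos_left h5 hB0.le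
    have := abs_nonneg (P.err (K * B) i j)
    linarith
  have hn0 : (0 : ℝ) < n := by exact_mod_cast hn
  have hn15 : ((n : ℝ) ^ (1.5 : ℝ)) ^ 2 = (n : ℝ) ^ 3 := by
    rw [← Real.rpow_natCast, ← Real.rpow_mul hn0.le, ← Real.rpow_natCast]; norm_num
  have hn15pos : 0 < (n : ℝ) ^ (1.5 : ℝ) := Real.rpow_pos_of_pos hn0 _
  rw [mul_div_assoc, ← mul_one_div ((n : ℝ) ^ (1.5 : ℝ))] at hV
  have hV2 := pow_le_pow_left₀ (by positivity) hV 2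
  rw [V2_sq, mul_pow, mul_pow, hn15] at hV2
  have hpos : 0 < sqDev (P.x (K * B)) := lt_of_lt_of_le (by positivity) hV2
  obtain ⟨i, j, hadj, hij⟩ := exists_adj_sqDev_le hcore.2.1 _ hpos
  have hfire : ∀ k, ∃ s, k * B ≤ s ∧ s + 1 ≤ (k + 1) * B ∧ P.E (s + 1) i j := by
    intro k
    rw [SimpleGraph.fromRel_adj] at hadj
    rcases hadj.2 with h | h
    · obtain ⟨s, h1, h2, h3⟩ := hcore.2.2 k _ _ h
      exact ⟨s - 1, by omega, by omega, by rwa [Nat.sub_add_cancel (by omega)]⟩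
    · obtain ⟨s, h1, h2, h3⟩ := hcore.2.2 k _ _ h
      exact ⟨s - 1, by omega, by omega,
        by rw [Nat.sub_add_cancel (by omega)]; exact P.Esymm _ _ _ h3⟩
  have hfire' : ∀ k, ∃ s, k * B ≤ s ∧ s + 1 ≤ (k + 1) * B ∧ P.E (s + 1) j i := by
    intro k
    obtain ⟨s, h1, h2, h3⟩ := hfire k
    exact ⟨s, h1, h2, P.Esymm _ _ _ h3⟩
  have hgap : 8 * (1 / ((K * B : ℕ) : ℝ) ^ P.α) ≤ |P.x (K * B) i - P.x (K * B) j| := by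
    refine le_of_sq_le_sq ?_ (abs_nonneg _)
    rw [sq_abs]
    refine le_of_mul_le_mul_left ?_ (show 0 < (n : ℝ) ^ 3 by positivity)
    linarith
  obtain ⟨hD, hdec⟩ := Protocol.sqDev_decrease_of_edge ht128 hB hDsup
    (fun l _ => by
      obtain ⟨s, h1, h2, h3⟩ := hfire (K + l)
      exact ⟨s, by linarith, by linarith, h3⟩)
    (fun r hr i => Protocol.abs_x_succ_sub_le_of_le htpos hr i) (hdrift K hk₀K)
    (htrack i j hfire) (htrack j i hfire') hgap
  have hT1 : 1 ≤ (((K * B : ℕ) : ℝ) + 3 * B) ^ P.β :=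
    Real.one_le_rpow (by linarith) (P.hα.trans P.hαβ).le
  set T := (((K * B : ℕ) : ℝ) + 3 * B) ^ P.β
  set c := 1 / (50 * (n : ℝ) ^ 3 * Dsup * T) with hc
  have hDT : 1 ≤ Dsup * T := one_le_mul_of_one_le_of_one_le hD hT1
  have hc1 : c ≤ 1 := by
    have h3 : (1 : ℝ) ≤ (n : ℝ) ^ 3 := one_le_pow₀ (by exact_mod_cast hn)
    have := one_le_mul_of_one_le_of_one_le h3 hDT
    rw [hc, div_le_one (by linarith)]
    linarith
  have hdec' : 2 * c * sqDev (P.x (K * B)) ≤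
      1 / (25 * (Dsup * T)) * (P.x (K * B) i - P.x (K * B) j) ^ 2 := by
    have hD0 : 0 < Dsup := by linarith
    have hT0 : 0 < T := by linarith
    have : 1 / (25 * (Dsup * T)) = 2 * c * (n : ℝ) ^ 3 := by
      rw [hc]; field_simp; norm_num
    rw [this, mul_assoc (2 * c)]
    exact mul_le_mul_of_nonneg_left hij (by positivity)
  refine le_of_sq_le_sq ?_ (mul_nonneg (by linarith) (Real.sqrt_nonneg _))
  rw [mul_pow, V2_sq, V2_sq]
  nlinarith [mul_nonneg (sq_nonneg c) hpos.le]
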